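/- The matrices u₁, …, u₈ satisfy the following relations in SL₂(ℂ) (I denotes the 2×2 identity matrix): u₃³ = −I; u₄³ = −I; (u₂u₁)³ = I; (u₂u₁⁻¹)³ = I; u₆u₃u₇ = −I; u₆u₇u₄⁻¹ = −I; u₈u₃u₅ = −I; u₄⁻¹u₈u₅ = −I; u₁u₃⁻¹u₁u₄⁻¹ = I; u₅⁻¹u₂u₅⁻¹u₁⁻¹u₈u₂u₈u₁ = I; u₆u₂⁻¹u₆u₁u₇⁻¹u₂⁻¹u₇⁻¹u₁⁻¹ = I. -/

import Mathlib

open Complex Matrix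

/-- The golden ratio `θ = (1+√5)/2`, with conjugate `θ̄ = 1 − θ`. -/
noncomputable def gr : ℝ := (1 + Real.sqrt 5) / 2

noncomputable def u₁ : Matrix (Fin 2) (Fin 2) ℂ :=
  !![I * (gr : ℂ), 0; 0, I * (1 - (gr : ℂ))]
noncomputable def u₂ : Matrix (Fin 2) (Fin 2) ℂ :=
  !![I, 1 + I; I - 1, I]
noncomputable def u₃ : Matrix (Fin 2) (Fin 2) ℂ :=
  !![(gr : ℂ), 1 + I; I - 1, 1 - (gr : ℂ)]
noncomputable def u₄ : Matrix (Fin 2) (Fin 2) ℂ :=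
  !![(gr : ℂ), -1 - I; 1 - I, 1 - (gr : ℂ)]
noncomputable def u₅ : Matrix (Fin 2) (Fin 2) ℂ :=
  !![1 + I, 1 + I * (1 - (gr : ℂ)); I * (1 + I * (gr : ℂ)), 1 + I]
noncomputable def u₆ : Matrix (Fin 2) (Fin 2) ℂ :=
  !![1 + I, 1 + I * (gr : ℂ); I * (1 + I * (1 - (gr : ℂ))), 1 + I]
noncomputable def u₇ : Matrix (Fin 2) (Fin 2) ℂ :=
  !![1 - I, (1 - (gr : ℂ)) + I; I * ((gr : ℂ) + I), 1 - I]
noncomputable def u₈ : Matrix (Fin 2) (Fin 2) ℂ :=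
  !![1 - I, (gr : ℂ) + I; I * ((1 - (gr : ℂ)) + I), 1 - I]

theorem gr_sq : (gr : ℂ) * gr = gr + 1 := by
  have h : gr * gr = gr + 1 := by
    have := Real.mul_self_sqrt (show (0:ℝ) ≤ 5 by norm_num)
    unfold gr; linarith
  exact_mod_cast h

theorem mat_ext {a b c d a' b' c' d' : ℂ} (h1 : a = a') (h2 : b = b') (h3 : c = c') (h4 : d = d') :
    !![a, b; c, d] = !![a', b'; c', d'] := by rw [h1, h2, h3, h4]

theorem inv_1 : u₁⁻¹ = !![I * (1 - (gr : ℂ)), 0; 0, I * (gr : ℂ)] := by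
  have hg := gr_sq
  have hI := I_mul_I
  apply Matrix.inv_eq_right_inv
  rw [u₁, Matrix.mul_fin_two, Matrix.one_fin_two]
  apply mat_ext <;> grind

theorem inv_2 : u₂⁻¹ = !![I, -(1 + I); -(I - 1), I] := by
  have hg := gr_sq
  have hI := I_mul_I
  apply Matrix.inv_eq_right_inv
  rw [u₂, Matrix.mul_fin_two, Matrix.one_fin_two]
  apply mat_ext <;> grind

theorem inv_3 : u₃⁻¹ = !![1 - (gr : ℂ), -(1 + I); -(I - 1), (gr : ℂ)] := by
  have hg := gr_sq
  have hI := I_mul_I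
  apply Matrix.inv_eq_right_inv
  rw [u₃, Matrix.mul_fin_two, Matrix.one_fin_two]
  apply mat_ext <;> grind

theorem inv_4 : u₄⁻¹ = !![1 - (gr : ℂ), -(-1 - I); -(1 - I), (gr : ℂ)] := by
  have hg := gr_sq
  have hI := I_mul_I
  apply Matrix.inv_eq_right_inv
  rw [u₄, Matrix.mul_fin_two, Matrix.one_fin_two]
  apply mat_ext <;> grind

theorem inv_5 : u₅⁻¹ = !![1 + I, -(1 + I * (1 - (gr : ℂ))); -(I * (1 + I * (gr : ℂ))), 1 + I] := by
  have hg := gr_sq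
  have hI := I_mul_I
  apply Matrix.inv_eq_right_inv
  rw [u₅, Matrix.mul_fin_two, Matrix.one_fin_two]
  apply mat_ext <;> grind

theorem inv_7 : u₇⁻¹ = !![1 - I, -((1 - (gr : ℂ)) + I); -(I * ((gr : ℂ) + I)), 1 - I] := by
  have hg := gr_sq
  have hI := I_mul_I
  apply Matrix.inv_eq_right_inv
  rw [u₇, Matrix.mul_fin_two, Matrix.one_fin_two]
  apply mat_ext <;> grind

/-- The fundamental relations among the generators `u₁,…,u₈` of `O¹` (Table II):
`u₃³ = −I`, `u₄³ = −I`, `(u₂u₁)³ = I`, `(u₂u₁⁻¹)³ = I`, `u₆u₃u₇ = −I`, `u₆u₇u₄⁻¹ = −I`,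
`u₈u₃u₅ = −I`, `u₄⁻¹u₈u₅ = −I`, `u₁u₃⁻¹u₁u₄⁻¹ = I`, `u₅⁻¹u₂u₅⁻¹u₁⁻¹u₈u₂u₈u₁ = I`,
`u₆u₂⁻¹u₆u₁u₇⁻¹u₂⁻¹u₇⁻¹u₁⁻¹ = I`. -/
theorem generator_relations :
    u₃ ^ 3 = -1 ∧
    u₄ ^ 3 = -1 ∧
    (u₂ * u₁) ^ 3 = 1 ∧
    (u₂ * u₁⁻¹) ^ 3 = 1 ∧
    u₆ * u₃ * u₇ = -1 ∧
    u₆ * u₇ * u₄⁻¹ = -1 ∧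
    u₈ * u₃ * u₅ = -1 ∧
    u₄⁻¹ * u₈ * u₅ = -1 ∧
    u₁ * u₃⁻¹ * u₁ * u₄⁻¹ = 1 ∧
    u₅⁻¹ * u₂ * u₅⁻¹ * u₁⁻¹ * u₈ * u₂ * u₈ * u₁ = 1 ∧
    u₆ * u₂⁻¹ * u₆ * u₁ * u₇⁻¹ * u₂⁻¹ * u₇⁻¹ * u₁⁻¹ = 1 := by
  have hg := gr_sq
  have hI := I_mul_I
  have hn : (-!![1, 0; 0, 1] : Matrix (Fin 2) (Fin 2) ℂ) = !![-1, 0; 0, -1] := by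
    simp
  refine ⟨?_, ?_, ?_, ?_, ?_, ?_, ?_, ?_, ?_, ?_, ?_⟩
  all_goals
    try simp only [inv_1, inv_2, inv_3, inv_4, inv_5, inv_7, pow_succ, pow_zero, one_mul]
    simp only [u₁, u₂, u₃, u₄, u₅, u₆, u₇, u₈, Matrix.mul_fin_two, Matrix.one_fin_two, hn]
    generalize (gr : ℂ) = t at *
    apply mat_ext <;> grind
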